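/- Let F = F_{2^m} with m even, and let a ∈ F be a primitive third root of unity (a^3 = 1, a ≠ 1). Then the Kloosterman sum K(a) = Σ_{x∈F*} (-1)^{Tr(ax + 1/x)} satisfies K(a) ≡ 7 (mod 12) if Tr(a) = 0 and K(a) ≡ 11 (mod 12) if Tr(a) = 1. -/

import Mathlib

open Finset

noncomputable local instance (m : ℕ) : Fintype (GaloisField 2 m) := Fintype.ofFinite _

noncomputable local instance (m : ℕ) : DecidableEq (GaloisField 2 m) := Classical.decEq _

noncomputable def Tr (m : ℕ) (x : GaloisField 2 m) : ZMod 2 :=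
  Algebra.trace (ZMod 2) (GaloisField 2 m) x

noncomputable def K (m : ℕ) (a : GaloisField 2 m) : ℤ :=
  ∑ x ∈ Finset.univ.erase (0 : GaloisField 2 m), (-1 : ℤ) ^ (Tr m (a * x + x⁻¹)).val

set_option linter.unusedSectionVars false

namespace KProof

variable {F : Type*} [Field F] [Fintype F] [DecidableEq F] [Algebra (ZMod 2) F]

/-- The additive character attached to the trace. -/
noncomputable def chi (x : F) : ℤ := (-1 : ℤ) ^ (Algebra.trace (ZMod 2) F x).val

lemma sign_add : ∀ u v : ZMod 2, (-1 : ℤ) ^ (u + v).val = (-1 : ℤ) ^ u.val * (-1 : ℤ) ^ v.val := by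
  decide

lemma sign_eq : ∀ u : ZMod 2, (-1 : ℤ) ^ u.val = 1 - 2 * (u.val : ℤ) := by
  decide

lemma chi_add (x y : F) : chi (x + y) = chi x * chi y := by
  unfold chi
  rw [map_add, sign_add]

lemma two_eq : (2 : F) = 0 := by
  have h : (algebraMap (ZMod 2) F) 2 = 0 := by
    have : (2 : ZMod 2) = 0 := by decide
    rw [this, map_zero]
  rw [map_ofNat] at h
  exact h

lemma add_self (x : F) : x + x = 0 := by
  have := two_eq (F := F)
  linear_combination x * this

lemma trace_sq (x : F) :
    Algebra.trace (ZMod 2) F (x ^ 2) = Algebra.trace (ZMod 2) F x := by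
  have h := Algebra.trace_eq_of_algEquiv (FiniteField.frobeniusAlgEquivOfAlgebraic (ZMod 2) F) x
  simpa [ZMod.card] using h

/-- The Artin-Schreier map. -/
noncomputable def AS (F : Type*) [Field F] [Algebra (ZMod 2) F] : F →ₗ[ZMod 2] F :=
  (FiniteField.frobeniusAlgHom (ZMod 2) F).toLinearMap + LinearMap.id

lemma AS_apply (x : F) : AS F x = x ^ 2 + x := by
  simp [AS, ZMod.card]

lemma AS_eq_zero (x : F) : AS F x = 0 ↔ x = 0 ∨ x = 1 := by
  have h2 := two_eq (F := F)
  rw [AS_apply]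
  constructor
  · intro h
    have : x * (x - 1) = 0 := by linear_combination h - x * h2
    rcases mul_eq_zero.1 this with h | h
    · exact Or.inl h
    · exact Or.inr (sub_eq_zero.1 h)
  · rintro (rfl | rfl)
    · simp
    · linear_combination h2

lemma AS_range : LinearMap.range (AS F) = LinearMap.ker (Algebra.trace (ZMod 2) F) := by
  have : Module.Finite (ZMod 2) F := Module.Finite.of_finite
  apply Submodule.eq_of_le_of_finrank_eq
  · rintro _ ⟨x, rfl⟩
    rw [LinearMap.mem_ker, AS_apply, map_add, trace_sq]
    exact CharTwo.add_self_eq_zero _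
  · have h1 := LinearMap.finrank_range_add_finrank_ker (AS F)
    have h2 := LinearMap.finrank_range_add_finrank_ker (Algebra.trace (ZMod 2) F)
    have h3 : Module.finrank (ZMod 2) (LinearMap.range (Algebra.trace (ZMod 2) F)) = 1 := by
      rw [LinearMap.range_eq_top.2 (Algebra.trace_surjective (ZMod 2) F)]
      simp
    have h4 : Module.finrank (ZMod 2) (LinearMap.ker (AS F)) = 1 := by
      apply finrank_eq_one (⟨1, by rw [LinearMap.mem_ker, AS_eq_zero]; simp⟩ : LinearMap.ker (AS F))
      · intro h
        exact one_ne_zero (congrArg Subtype.val h)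
      · rintro ⟨w, hw⟩
        rw [LinearMap.mem_ker, AS_eq_zero] at hw
        rcases hw with rfl | rfl
        · exact ⟨0, by ext; simp⟩
        · exact ⟨1, by ext; simp⟩
    omega

lemma chi_sq (x : F) : chi (x ^ 2) = chi x := by
  unfold chi; rw [trace_sq]

lemma chi_AS (v : F) : chi (v ^ 2 + v) = 1 := by
  unfold chi
  rw [map_add, trace_sq, CharTwo.add_self_eq_zero]; simp

lemma card_AS (c : F) : ((univ.filter (fun v : F => v ^ 2 + v = c)).card : ℤ) = 1 + chi c := by
  have h2 := two_eq (F := F)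
  by_cases hc : Algebra.trace (ZMod 2) F c = 0
  · have : c ∈ LinearMap.range (AS F) := by rw [AS_range]; exact hc
    obtain ⟨v, hv⟩ := this
    rw [AS_apply] at hv
    have : univ.filter (fun v : F => v ^ 2 + v = c) = {v, v + 1} := by
      ext u
      simp only [mem_filter, mem_univ, true_and, mem_insert, mem_singleton]
      constructor
      · intro hu
        have := (AS_eq_zero (u - v)).1 (by rw [map_sub, AS_apply, AS_apply, hu, hv, sub_self])
        rcases this with h | h
        · exact Or.inl (sub_eq_zero.1 h)
        · right; linear_combination h
      · rintro (rfl | rfl)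
        · exact hv
        · linear_combination hv + (v + 1) * h2
    rw [this, card_pair (by simp)]
    simp [chi, hc]
  · have : univ.filter (fun v : F => v ^ 2 + v = c) = ∅ := by
      rw [filter_eq_empty_iff]
      intro v _ hv
      apply hc
      rw [← hv, map_add, trace_sq]
      exact CharTwo.add_self_eq_zero _
    have h1 : ∀ u : ZMod 2, u ≠ 0 → 1 + (-1 : ℤ) ^ u.val = 0 := by decide
    rw [this, card_empty]
    exact (h1 _ hc).symm

/-- For a fixed `y` other than `0, 1`, the number of `w`. -/
lemma card_fiber (a : F) (ha : a ^ 2 + a + 1 = 0) (hT1 : Algebra.trace (ZMod 2) F 1 = 0)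
    (y : F) (y0 : y ≠ 0) (y1 : y ≠ 1) :
    ((univ.filter (fun w : F => y * w * (y + w + 1) = a)).card : ℤ)
      = 1 + chi (a * (y⁻¹ + 1) + (y⁻¹ + 1)⁻¹ + a) := by
  have h2 := two_eq (F := F)
  have hy1 : y + 1 ≠ 0 := by
    intro h; apply y1; linear_combination h - h2
  have hchi : chi (a * (y⁻¹ + 1) + (y⁻¹ + 1)⁻¹ + a) = chi (a / (y * (y + 1) ^ 2)) := by
    have hone : chi (1 : F) = 1 := by simp [chi, hT1]
    have e1 : a * (y⁻¹ + 1) + (y⁻¹ + 1)⁻¹ + a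
        = a / (y * (y + 1) ^ 2) + ((a ^ 2 / (y + 1)) ^ 2 + a ^ 2 / (y + 1)) + 1 := by
      have e0 : y⁻¹ + 1 = (y + 1) / y := by field_simp; ring
      have e4 : a ^ 4 = a := by linear_combination (a ^ 2 - a) * ha
      rw [e0, div_pow, ← pow_mul, e4, inv_div]
      field_simp
      grind
    rw [e1, chi_add, chi_add, chi_AS, hone]; ring
  rw [hchi, ← card_AS]
  congr 1
  symm
  refine card_bij' (fun v _ => (y + 1) * v) (fun w _ => w / (y + 1)) ?_ ?_ ?_ ?_
  · intro v hv
    simp only [mem_filter, mem_univ, true_and] at hv ⊢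
    rw [eq_div_iff (by simp [y0, hy1])] at hv
    linear_combination hv
  · intro v hv
    simp only [mem_filter, mem_univ, true_and] at hv ⊢
    field_simp
    linear_combination hv
  · intro v _
    field_simp
  · intro v _
    field_simp

lemma card_fiber_one (a : F) (ha : a ^ 2 + a + 1 = 0) :
    (univ.filter (fun w : F => 1 * w * (1 + w + 1) = a)).card = 1 := by
  have h2 := two_eq (F := F)
  rw [card_eq_one]
  refine ⟨a ^ 2, ?_⟩
  ext w
  simp only [mem_filter, mem_univ, true_and, mem_singleton]
  constructor
  · intro h
    have : (w - a ^ 2) ^ 2 = 0 := by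
      linear_combination h + a * h2 - w * h2 - a ^ 2 * w * h2 + (a ^ 2 - a) * ha
    exact sub_eq_zero.1 (pow_eq_zero_iff (two_ne_zero)|>.1 this)
  · rintro rfl
    linear_combination a ^ 2 * h2 + (a ^ 2 - a) * ha

lemma card_S_mod (a : F) (h1 : a ≠ 1) :
    (3 : ℤ) ∣ ((univ.filter (fun p : F × F => p.1 * p.2 * (p.1 + p.2 + 1) = a)).card : ℤ) := by
  have h2 := two_eq (F := F)
  let f : Function.End {p : F × F // p.1 * p.2 * (p.1 + p.2 + 1) = a} := fun p =>
    ⟨(p.1.2, p.1.1 + p.1.2 + 1), by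
      have := p.2
      dsimp only
      linear_combination this + p.1.2 * (p.1.1 + p.1.2 + 1) * (p.1.2 + 1) * h2⟩
  have hf : f ^ 3 ^ 1 = 1 := by
    funext p
    obtain ⟨⟨y, w⟩, h⟩ := p
    apply Subtype.ext
    apply Prod.ext
    · change w + (y + w + 1) + 1 = y
      linear_combination (w + 1) * h2
    · change (y + w + 1) + (w + (y + w + 1) + 1) + 1 = w
      linear_combination (y + w + w) * h2 + (2 - w) * h2
  have hc := Equiv.Perm.card_fixedPoints_modEq (p := 3) (n := 1) hf
  have h0 : Fintype.card f.fixedPoints = 0 := by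
    rw [Fintype.card_eq_zero_iff]
    constructor
    rintro ⟨⟨⟨y, w⟩, h⟩, hfix⟩
    have e := congrArg Subtype.val hfix
    have e1 : w = y := congrArg Prod.fst e
    have e2 : y + w + 1 = w := congrArg Prod.snd e
    subst e1
    have : w = 1 := by linear_combination e2 - h2 
    subst this
    apply h1
    dsimp only at h
    linear_combination -h + h2
  rw [h0, Fintype.card_subtype] at hc
  exact_mod_cast (Nat.modEq_zero_iff_dvd.1 hc)

lemma main3 (a : F) (ha : a ^ 2 + a + 1 = 0) (hT1 : Algebra.trace (ZMod 2) F 1 = 0) :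
    (3 : ℤ) ∣ (Fintype.card F : ℤ) - 2 +
      chi a * ∑ x ∈ univ.erase (0 : F), chi (a * x + x⁻¹) := by
  have h2 := two_eq (F := F)
  have h1 : a ≠ 1 := by
    rintro rfl
    exact one_ne_zero (α := F) (by linear_combination ha - h2)
  have a0 : a ≠ 0 := by
    rintro rfl
    simp at ha
  have hS := card_S_mod a h1
  have hsum : ((univ.filter (fun p : F × F => p.1 * p.2 * (p.1 + p.2 + 1) = a)).card : ℤ)
      = ∑ y : F, ((univ.filter (fun w : F => y * w * (y + w + 1) = a)).card : ℤ) := by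
    simp only [card_filter, Nat.cast_sum]
    rw [← univ_product_univ, sum_product]
  have hz : ((univ.filter (fun w : F => 0 * w * (0 + w + 1) = a)).card : ℤ) = 0 := by
    simp [a0.symm]
  have hmem : (1 : F) ∈ univ.erase (0 : F) := by simp
  rw [hsum, ← add_sum_erase _ _ (mem_univ (0 : F)), hz, ← add_sum_erase _ _ hmem,
    card_fiber_one a ha] at hS
  have hre : ∑ y ∈ (univ.erase (0 : F)).erase 1,
      ((univ.filter (fun w : F => y * w * (y + w + 1) = a)).card : ℤ)
      = ∑ t ∈ (univ.erase (0 : F)).erase 1, (1 + chi (a * t + t⁻¹ + a)) := by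
    have key : ∀ y : F, y ≠ 1 → y + 1 ≠ 0 := by
      intro y hy h
      apply hy; linear_combination h - h2
    refine sum_nbij' (fun y => y⁻¹ + 1) (fun t => (t + 1)⁻¹) ?_ ?_ ?_ ?_ ?_
    · intro y hy
      simp only [mem_erase, mem_univ, and_true] at hy ⊢
      refine ⟨by simpa using hy.2, key _ (by simpa using hy.1)⟩
    · intro y hy
      simp only [mem_erase, mem_univ, and_true] at hy ⊢
      refine ⟨by simpa using hy.2, inv_ne_zero (key _ hy.1)⟩
    · intro y hy
      have : y⁻¹ + 1 + 1 = y⁻¹ := by linear_combination h2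
      simp only [this, inv_inv]
    · intro y hy
      simp only [inv_inv]
      linear_combination h2
    · intro y hy
      simp only [mem_erase, mem_univ, and_true] at hy
      exact card_fiber a ha hT1 y hy.2 hy.1
  have hval : chi (a * 1 + (1 : F)⁻¹ + a) = 1 := by
    have : a * 1 + (1 : F)⁻¹ + a = 1 := by rw [inv_one]; linear_combination a * h2
    rw [this]; simp [chi, hT1]
  have hfull : ∑ t ∈ univ.erase (0 : F), (1 + chi (a * t + t⁻¹ + a))
      = (Fintype.card F : ℤ) - 1 + chi a * ∑ x ∈ univ.erase (0 : F), chi (a * x + x⁻¹) := by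
    rw [sum_add_distrib, mul_sum]
    congr 1
    · rw [sum_const, card_erase_of_mem (mem_univ _), card_univ, nsmul_eq_mul, mul_one,
        Nat.cast_sub Fintype.card_pos, Nat.cast_one]
    · refine sum_congr rfl fun x _ => ?_
      rw [chi_add, mul_comm]
  rw [← add_sum_erase _ _ hmem, hval] at hfull
  rw [hre] at hS
  push_cast at hS
  omega

lemma main4 (a : F) (h4 : (4 : ℤ) ∣ Fintype.card F) :
    (4 : ℤ) ∣ (∑ x ∈ univ.erase (0 : F), chi (a * x + x⁻¹)) + 1 := by
  have hs : ∑ x : F, x = 0 := by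
    have := FiniteField.sum_pow_lt_card_sub_one F 1 (by
      have := Fintype.card_pos (α := F)
      omega)
    simpa using this
  have hsi : ∑ x : F, x⁻¹ = 0 := by
    rw [← hs]
    exact Equiv.sum_comp (Equiv.inv F) (fun x => x)
  have hev : (2 : ℤ) ∣ ∑ x ∈ univ.erase (0 : F),
      ((Algebra.trace (ZMod 2) F (a * x + x⁻¹)).val : ℤ) := by
    have : ((∑ x ∈ univ.erase (0 : F),
      ((Algebra.trace (ZMod 2) F (a * x + x⁻¹)).val : ℤ) : ℤ) : ZMod 2) = 0 := by
      push_cast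
      simp only [ZMod.natCast_val, ZMod.cast_id', id_eq]
      rw [← map_sum, sum_erase _ (by simp), sum_add_distrib, ← mul_sum, hs, hsi]
      simp
    exact_mod_cast (ZMod.intCast_zmod_eq_zero_iff_dvd _ 2).1 this
  have hE : ∑ x ∈ univ.erase (0 : F), chi (a * x + x⁻¹)
      = (Fintype.card F : ℤ) - 1 - 2 * ∑ x ∈ univ.erase (0 : F),
      ((Algebra.trace (ZMod 2) F (a * x + x⁻¹)).val : ℤ) := by
    unfold chi
    simp only [sign_eq]
    rw [sum_sub_distrib, mul_sum, sum_const, card_erase_of_mem (mem_univ _), card_univ,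
      nsmul_eq_mul, mul_one, Nat.cast_sub Fintype.card_pos, Nat.cast_one]
  rw [hE]
  omega

end KProof

theorem kloosterman_third_root (m : ℕ) (hm : 0 < m) (heven : Even m)
    (a : GaloisField 2 m) (h3 : a ^ 3 = 1) (h1 : a ≠ 1) :
    (Tr m a = 0 → K m a ≡ 7 [ZMOD 12]) ∧ (Tr m a = 1 → K m a ≡ 11 [ZMOD 12]) := by
  obtain ⟨k, hk⟩ := heven
  have ha : a ^ 2 + a + 1 = 0 := by
    have : (a - 1) * (a ^ 2 + a + 1) = 0 := by linear_combination h3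
    exact (mul_eq_zero.1 this).resolve_left (sub_ne_zero.2 h1)
  have hT1 : Algebra.trace (ZMod 2) (GaloisField 2 m) 1 = 0 := by
    have := Algebra.trace_algebraMap (S := GaloisField 2 m) (1 : ZMod 2)
    rw [map_one, GaloisField.finrank 2 hm.ne'] at this
    rw [this]
    conv_lhs => rw [hk]
    rw [add_smul, CharTwo.add_self_eq_zero]
  have hcard : (Fintype.card (GaloisField 2 m) : ℤ) = 4 ^ k := by
    rw [← Nat.card_eq_fintype_card, GaloisField.card 2 m hm.ne', hk, ← two_mul, pow_mul]
    norm_num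
  have h4 : (4 : ℤ) ∣ Fintype.card (GaloisField 2 m) := by
    rw [hcard]
    exact dvd_pow_self _ (by omega)
  have hq3 : (3 : ℤ) ∣ Fintype.card (GaloisField 2 m) - 1 := by
    rw [hcard]
    simpa using sub_one_dvd_pow_sub_one (4 : ℤ) k
  have A := KProof.main3 a ha hT1
  have B := KProof.main4 a h4
  change (3 : ℤ) ∣ _ - 2 + KProof.chi a * K m a at A
  change (4 : ℤ) ∣ K m a + 1 at B
  constructor
  · intro h
    have hc : KProof.chi a = 1 := by
      change (-1 : ℤ) ^ (Tr m a).val = 1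
      rw [h]; rfl
    rw [hc] at A
    unfold Int.ModEq
    omega
  · intro h
    have hc : KProof.chi a = -1 := by
      change (-1 : ℤ) ^ (Tr m a).val = -1
      rw [h]; rfl
    rw [hc] at A
    unfold Int.ModEq
    omega
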